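/- For any positive integer n and any even positive integer m, the number of conjugacy classes of the full orthogonal group O(2n+1) consisting of elements x with x^m = 1 equals 2 · C(n + m/2, m/2). -/

import Mathlib

open Matrix

/-- Polar decomposition: a real intertwiner of orthogonal matrices yields an orthogonal one. -/
theorem exists_orthogonal_intertwiner {ι : Type*} [Fintype ι] [DecidableEq ι]
    {x y c : Matrix ι ι ℝ} (hx : xᵀ * x = 1) (hy : y * yᵀ = 1) (hc : IsUnit c.det)
    (h : x * c = c * y) :
    ∃ q : Matrix ι ι ℝ, qᵀ * q = 1 ∧ x * q = q * y := by
  open scoped MatrixOrder Matrix.Norms.L2Operator in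
  have hnn : 0 ≤ cᵀ * c := by
    rw [Matrix.nonneg_iff_posSemidef]
    simpa using Matrix.posSemidef_conjTranspose_mul_self c
  have hcomm : Commute (cᵀ * c) y := by
    have h1 : y * cᵀ = cᵀ * x := by
      have h2 := congrArg (fun z => y * zᵀ * x) h
      simp only [Matrix.transpose_mul, Matrix.mul_assoc, hx, Matrix.mul_one] at h2
      rw [h2, ← Matrix.mul_assoc, hy, Matrix.one_mul]
    rw [Commute, SemiconjBy, Matrix.mul_assoc, ← h, ← Matrix.mul_assoc, ← h1, Matrix.mul_assoc]
  obtain ⟨s, hs0, hs, hsy⟩ : ∃ s : Matrix ι ι ℝ, sᵀ = s ∧ s * s = cᵀ * c ∧ Commute s y := by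
    refine ⟨CFC.sqrt (cᵀ * c), ?_, CFC.sqrt_mul_sqrt_self _ hnn, ?_⟩
    · have := (CFC.sqrt_nonneg (cᵀ * c)).isSelfAdjoint
      simpa [IsSelfAdjoint, Matrix.star_eq_conjTranspose] using this
    · exact hcomm.cfcₙ_nnreal _
  have hsu : IsUnit s.det := by
    have : IsUnit (s * s).det := by rw [hs]; simpa using hc
    rw [Matrix.det_mul] at this
    exact isUnit_of_mul_isUnit_left this
  have hys : y * s⁻¹ = s⁻¹ * y := by
    calc y * s⁻¹ = s⁻¹ * (s * y) * s⁻¹ := by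
          rw [← Matrix.mul_assoc, Matrix.nonsing_inv_mul _ hsu, Matrix.one_mul]
      _ = s⁻¹ * y := by
          rw [hsy.eq, Matrix.mul_assoc, Matrix.mul_assoc, Matrix.mul_nonsing_inv _ hsu,
            Matrix.mul_one]
  refine ⟨c * s⁻¹, ?_, ?_⟩
  · calc (c * s⁻¹)ᵀ * (c * s⁻¹) = s⁻¹ * (cᵀ * c) * s⁻¹ := by
          rw [Matrix.transpose_mul, Matrix.transpose_nonsing_inv, hs0]; simp [Matrix.mul_assoc]
      _ = 1 := by
          rw [← hs, ← Matrix.mul_assoc, Matrix.nonsing_inv_mul _ hsu, Matrix.one_mul,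
            Matrix.mul_nonsing_inv _ hsu]
  · rw [← Matrix.mul_assoc, h, Matrix.mul_assoc, hys, Matrix.mul_assoc]

/-- Real matrices that are intertwined by an invertible complex matrix are intertwined by an
invertible real one. -/
theorem exists_real_intertwiner {ι : Type*} [Fintype ι] [DecidableEq ι]
    {x y : Matrix ι ι ℝ} {p : Matrix ι ι ℂ} (hp : p.det ≠ 0)
    (h : x.map Complex.ofRealHom * p = p * y.map Complex.ofRealHom) :
    ∃ c : Matrix ι ι ℝ, IsUnit c.det ∧ x * c = c * y := by
  set a := p.map Complex.re with ha
  set b := p.map Complex.im with hb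
  have hre : x * a = a * y := by
    ext i j
    have := congrArg Complex.re (congrFun (congrFun h i) j)
    simpa [Matrix.mul_apply, ha] using this
  have him : x * b = b * y := by
    ext i j
    have := congrArg Complex.im (congrFun (congrFun h i) j)
    simpa [Matrix.mul_apply, hb] using this
  let q : Polynomial ℝ :=
    (a.map Polynomial.C + (Polynomial.X : Polynomial ℝ) • b.map Polynomial.C).det
  have hq : q ≠ 0 := by
    intro h0
    apply hp
    have h1 : q.eval₂ Complex.ofRealHom Complex.I = p.det := by
      change (Polynomial.eval₂RingHom Complex.ofRealHom Complex.I) q = _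
      rw [RingHom.map_det]
      congr 1
      ext i j
      simp [ha, hb]
    rw [← h1, h0, Polynomial.eval₂_zero]
  obtain ⟨t, ht⟩ : ∃ t : ℝ, q.eval t ≠ 0 := by
    by_contra! hcon
    exact hq (Polynomial.funext (by simpa using hcon))
  refine ⟨a + t • b, ?_, ?_⟩
  · rw [isUnit_iff_ne_zero]
    convert ht
    change _ = Polynomial.evalRingHom t q
    rw [RingHom.map_det]
    congr 1
    ext i j
    simp [mul_comm t]
  · rw [Matrix.mul_add, Matrix.add_mul, hre, Matrix.mul_smul, him, Matrix.smul_mul]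

/-- Semisimple endomorphisms over an algebraically closed field with the same characteristic
polynomial are conjugate. -/
theorem exists_linearEquiv_of_charpoly_eq {K V : Type*} [Field K] [IsAlgClosed K]
    [AddCommGroup V] [Module K V] [FiniteDimensional K V] {f g : Module.End K V}
    (hf : f.IsSemisimple) (hg : g.IsSemisimple) (h : f.charpoly = g.charpoly) :
    ∃ e : V ≃ₗ[K] V, ∀ v, e (g v) = f (e v) := by
  classical
  have key : ∀ {f : Module.End K V}, f.IsSemisimple →
      DirectSum.IsInternal (fun μ => f.eigenspace μ) := fun {f} hf =>
    (DirectSum.isInternal_submodule_iff_iSupIndep_and_iSup_eq_top _).2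
      ⟨f.eigenspaces_iSupIndep, hf.iSup_eigenspace_eq_top⟩
  have hdim : ∀ μ, Module.finrank K (g.eigenspace μ) = Module.finrank K (f.eigenspace μ) := by
    intro μ
    rw [← hf.isFinitelySemisimple.maxGenEigenspace_eq_eigenspace,
      ← hg.isFinitelySemisimple.maxGenEigenspace_eq_eigenspace,
      LinearMap.finrank_maxGenEigenspace_eq, LinearMap.finrank_maxGenEigenspace_eq, h]
  let eμ : ∀ μ, g.eigenspace μ ≃ₗ[K] f.eigenspace μ := fun μ =>
    LinearEquiv.ofFinrankEq _ _ (hdim μ)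
  let ef := LinearEquiv.ofBijective (DirectSum.coeLinearMap fun μ => f.eigenspace μ) (key hf)
  let eg := LinearEquiv.ofBijective (DirectSum.coeLinearMap fun μ => g.eigenspace μ) (key hg)
  refine ⟨eg.symm ≪≫ₗ DFinsupp.mapRange.linearEquiv eμ ≪≫ₗ ef, fun v => ?_⟩
  obtain ⟨w, rfl⟩ := eg.surjective v
  induction w using DirectSum.induction_on with
  | zero => simp
  | add a b ha hb => simp only [map_add, ha, hb]
  | of μ w =>
    have h1 : eg (DirectSum.of _ μ w) = (w : V) := by
      exact DirectSum.coeLinearMap_of _ _ _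
    have h2 : g (w : V) = eg (μ • DirectSum.of _ μ w) := by
      rw [map_smul, h1]; exact Module.End.mem_eigenspace_iff.1 w.2
    have h3 : ef (DFinsupp.mapRange.linearEquiv eμ (DirectSum.of _ μ w)) = (eμ μ w : V) := by
      have : DFinsupp.mapRange.linearEquiv eμ (DirectSum.of (fun μ => g.eigenspace μ) μ w) =
          DirectSum.of (fun μ => f.eigenspace μ) μ (eμ μ w) := 
        DFinsupp.mapRange_single (hf := fun _ => map_zero _)
      rw [this]
      exact DirectSum.coeLinearMap_of _ _ _
    rw [h1, h2]
    simp only [LinearEquiv.trans_apply, LinearEquiv.symm_apply_apply, map_smul, h3]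
    rw [← h1, LinearEquiv.symm_apply_apply, h3]
    exact (Module.End.mem_eigenspace_iff.1 (eμ μ w).2).symm

theorem exists_complex_intertwiner {ι : Type*} [Fintype ι] [DecidableEq ι] {m : ℕ} (hm : 0 < m)
    {x y : Matrix ι ι ℂ} (hx : x ^ m = 1) (hy : y ^ m = 1) (h : x.charpoly = y.charpoly) :
    ∃ p : Matrix ι ι ℂ, p.det ≠ 0 ∧ x * p = p * y := by
  have hss : ∀ {x : Matrix ι ι ℂ}, x ^ m = 1 → Module.End.IsSemisimple (Matrix.toLin' x) := by
    intro x hx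
    refine Module.End.isSemisimple_of_squarefree_aeval_eq_zero
      (p := Polynomial.X ^ m - 1) (Polynomial.X_pow_sub_one_separable_iff.2
        (Nat.cast_ne_zero.2 hm.ne')).squarefree ?_
    simp [← Matrix.toLin'_pow, hx, Module.End.one_eq_id]
  obtain ⟨e, he⟩ := exists_linearEquiv_of_charpoly_eq (hss hx) (hss hy)
    (by rwa [Matrix.charpoly_toLin', Matrix.charpoly_toLin'])
  refine ⟨LinearMap.toMatrix' e.toLinearMap, ?_, ?_⟩
  · rw [LinearMap.det_toMatrix']
    exact e.isUnit_det'.ne_zero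
  · apply Matrix.toLin'.injective
    apply LinearMap.ext
    intro v
    simpa [Matrix.toLin'_mul] using (he v).symm

/-- The `2k`-th root of unity `exp (π i j / k)` in the closed upper half plane. -/
noncomputable def upperRoot (k : ℕ) (j : Fin (k + 1)) : ℂ :=
  Complex.exp (((Real.pi * j / k : ℝ) : ℂ) * Complex.I)

/-- The multiset of eigenvalues of a block sum of the sign `ε` and the planar rotations with
eigenvalues `upperRoot k j` for `j ∈ s`. -/
noncomputable def rootData (k : ℕ) (ε : ℤˣ) (s : Multiset (Fin (k + 1))) : Multiset ℂ :=
  ((ε : ℤ) : ℂ) ::ₘ (s.map (upperRoot k) + s.map fun j => (starRingEnd ℂ) (upperRoot k j))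

theorem exists_upperRoot {k : ℕ} (hk : 0 < k) {z : ℂ} (hz : z ^ (2 * k) = 1) :
    ∃ j : Fin (k + 1), z = upperRoot k j ∨ z = (starRingEnd ℂ) (upperRoot k j) := by
  have hk' : (k : ℂ) ≠ 0 := by exact_mod_cast hk.ne'
  have : NeZero (2 * k) := ⟨by omega⟩
  obtain ⟨i, hi, rfl⟩ :=
    (Complex.isPrimitiveRoot_exp (2 * k) (by omega)).eq_pow_of_pow_eq_one hz
  rw [← Complex.exp_nat_mul]
  by_cases hik : i ≤ k
  · refine ⟨⟨i, by omega⟩, Or.inl ?_⟩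
    rw [upperRoot]
    congr 1
    push_cast
    field_simp
  · refine ⟨⟨2 * k - i, by omega⟩, Or.inr ?_⟩
    rw [upperRoot, ← Complex.exp_conj, Complex.exp_eq_exp_iff_exists_int]
    refine ⟨1, ?_⟩
    simp only [map_mul, Complex.conj_I, Complex.conj_ofReal]
    push_cast [hi.le]
    field_simp
    ring

theorem eq_one_or_neg_one_of_conj_eq {z : ℂ} {m : ℕ} (hm : m ≠ 0) (hz : z ^ m = 1)
    (h : (starRingEnd ℂ) z = z) : z = 1 ∨ z = -1 := by
  have h1 : ‖z‖ = 1 := Complex.norm_eq_one_of_pow_eq_one hz hm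
  rw [← sq_eq_one_iff, pow_two]
  nth_rewrite 2 [← h]
  rw [Complex.mul_conj, Complex.normSq_eq_norm_sq, h1]
  simp

theorem exists_pair_le {k : ℕ} (hk : 0 < k) {R : Multiset ℂ} (hcard : 2 < R.card)
    (hconj : R.map (starRingEnd ℂ) = R) (hR : ∀ z ∈ R, z ^ (2 * k) = 1) :
    ∃ z, {z, (starRingEnd ℂ) z} ≤ R := by
  by_cases h : ∃ z ∈ R, (starRingEnd ℂ) z ≠ z
  · obtain ⟨z, hz, hne⟩ := h
    refine ⟨z, ?_⟩
    have hz' : (starRingEnd ℂ) z ∈ R := by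
      rw [← hconj]; exact Multiset.mem_map_of_mem _ hz
    rw [Multiset.insert_eq_cons, Multiset.le_iff_subset (by simpa using hne.symm)]
    simp [Multiset.cons_subset, hz, hz']
  · push Not at h
    have hpm : ∀ z ∈ R, z = 1 ∨ z = -1 := fun z hz =>
      eq_one_or_neg_one_of_conj_eq (by omega) (hR z hz) (h z hz)
    have : 2 ≤ R.count 1 ∨ 2 ≤ R.count (-1) := by
      by_contra! hlt
      have hnd : R.Nodup := by
        rw [Multiset.nodup_iff_count_le_one]
        intro a
        by_cases ha : a ∈ R
        · rcases hpm a ha with rfl | rfl <;> omega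
        · simp [Multiset.count_eq_zero_of_notMem ha]
      have hle : R ≤ {1, -1} :=
        (Multiset.le_iff_subset hnd).2 fun a ha => by simpa using hpm a ha
      have := Multiset.card_le_card hle
      simp at this
      omega
    rcases this with h2 | h2
    · exact ⟨1, by simpa using Multiset.le_count_iff_replicate_le.1 h2⟩
    · exact ⟨-1, by simpa using Multiset.le_count_iff_replicate_le.1 h2⟩

theorem exists_eq_rootData {k : ℕ} (hk : 0 < k) (n : ℕ) {R : Multiset ℂ}
    (hcard : R.card = 2 * n + 1) (hconj : R.map (starRingEnd ℂ) = R)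
    (hR : ∀ z ∈ R, z ^ (2 * k) = 1) :
    ∃ (ε : ℤˣ) (s : Sym (Fin (k + 1)) n), R = rootData k ε s := by
  induction n generalizing R with
  | zero =>
    obtain ⟨z, rfl⟩ := Multiset.card_eq_one.1 hcard
    have hz : (starRingEnd ℂ) z = z := by simpa using hconj
    rcases eq_one_or_neg_one_of_conj_eq (by omega) (hR z (by simp)) hz with rfl | rfl
    · exact ⟨1, Sym.nil, by simp [rootData]⟩
    · exact ⟨-1, Sym.nil, by simp [rootData]⟩
  | succ n ih =>
    obtain ⟨z, hz⟩ := exists_pair_le hk (by omega) hconj hR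
    obtain ⟨R', rfl⟩ := Multiset.le_iff_exists_add.1 hz
    obtain ⟨ε, s, rfl⟩ := ih (R := R') (by simp at hcard; omega)
      (by
        simp only [Multiset.insert_eq_cons, Multiset.cons_add, Multiset.singleton_add,
          Multiset.map_cons, Complex.conj_conj] at hconj
        rw [Multiset.cons_swap] at hconj
        simpa only [Multiset.cons_inj_right] using hconj)
      (fun w hw => hR w (by simp [hw]))
    obtain ⟨j, hj⟩ := exists_upperRoot hk (hR z (by simp))
    refine ⟨ε, j ::ₛ s, ?_⟩
    have : ({z, (starRingEnd ℂ) z} : Multiset ℂ)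
        = {upperRoot k j, (starRingEnd ℂ) (upperRoot k j)} := by
      rcases hj with rfl | rfl
      · rfl
      · rw [Complex.conj_conj, Multiset.pair_comm]
    rw [this]
    simp only [rootData, Sym.coe_cons, Multiset.map_cons, Multiset.insert_eq_cons,
      Multiset.cons_add, Multiset.add_cons, Multiset.singleton_add]
    rw [Multiset.cons_swap (upperRoot k j)]

theorem upperRoot_re (k : ℕ) (j : Fin (k + 1)) :
    (upperRoot k j).re = Real.cos (Real.pi * j / k) := by
  rw [upperRoot, Complex.exp_ofReal_mul_I_re]

theorem upperRoot_re_injective {k : ℕ} (hk : 0 < k) :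
    Function.Injective fun j => (upperRoot k j).re := by
  intro i j h
  simp only [upperRoot_re] at h
  have hk' : (0 : ℝ) < k := by exact_mod_cast hk
  have hmem : ∀ j : Fin (k + 1), Real.pi * j / k ∈ Set.Icc 0 Real.pi := by
    intro j
    refine ⟨by positivity, ?_⟩
    rw [div_le_iff₀ hk']
    have : (j : ℝ) ≤ k := by exact_mod_cast Nat.lt_succ_iff.1 j.2
    gcongr
  have := Real.injOn_cos (hmem i) (hmem j) h
  field_simp at this
  exact Fin.ext (by exact_mod_cast this)

theorem rootData_map_re (k : ℕ) (ε : ℤˣ) (s : Multiset (Fin (k + 1))) :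
    (rootData k ε s).map Complex.re =
      ((ε : ℤ) : ℝ) ::ₘ (2 • s.map fun j => (upperRoot k j).re) := by
  simp [rootData, two_nsmul]

theorem rootData_injective {k : ℕ} (hk : 0 < k) {ε ε' : ℤˣ} {s s' : Multiset (Fin (k + 1))}
    (h : rootData k ε s = rootData k ε' s') : ε = ε' ∧ s = s' := by
  have h1 := congrArg (Multiset.map Complex.re) h
  rw [rootData_map_re, rootData_map_re] at h1
  have hε : ((ε : ℤ) : ℝ) = ((ε' : ℤ) : ℝ) := by
    by_contra hne
    have := congrArg (Multiset.count ((ε : ℤ) : ℝ)) h1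
    rw [Multiset.count_cons_self, Multiset.count_cons_of_ne hne, Multiset.count_nsmul,
      Multiset.count_nsmul] at this
    omega
  rw [hε, Multiset.cons_inj_right] at h1
  refine ⟨Units.ext (by exact_mod_cast hε), ?_⟩
  refine Multiset.map_injective (upperRoot_re_injective hk) ?_
  ext a
  have := congrArg (Multiset.count a) h1
  rw [Multiset.count_nsmul, Multiset.count_nsmul] at this
  omega

theorem charpoly_blockDiagonal {o ι R : Type*} [Fintype o] [DecidableEq o] [Fintype ι]
    [DecidableEq ι] [CommRing R] (M : o → Matrix ι ι R) :
    (blockDiagonal M).charpoly = ∏ i, (M i).charpoly := by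
  simp only [Matrix.charpoly]
  rw [← det_blockDiagonal]
  congr 1
  ext ⟨i, a⟩ ⟨j, b⟩
  by_cases hab : a = b
  · subst hab
    simp [charmatrix_apply, blockDiagonal_apply, diagonal_apply]
  · simp [blockDiagonal_apply, hab]

/-- The planar rotation of angle `θ`. -/
noncomputable def rotationMatrix (θ : ℝ) : Matrix (Fin 2) (Fin 2) ℝ :=
  !![Real.cos θ, -Real.sin θ; Real.sin θ, Real.cos θ]

theorem rotationMatrix_mul (α β : ℝ) :
    rotationMatrix α * rotationMatrix β = rotationMatrix (α + β) := by
  ext i j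
  fin_cases i <;> fin_cases j <;>
    simp [rotationMatrix, Matrix.mul_apply, Fin.sum_univ_two, Real.cos_add, Real.sin_add] <;> ring

theorem rotationMatrix_zero : rotationMatrix 0 = 1 := by
  ext i j
  fin_cases i <;> fin_cases j <;> simp [rotationMatrix]

theorem rotationMatrix_transpose (θ : ℝ) : (rotationMatrix θ)ᵀ = rotationMatrix (-θ) := by
  ext i j
  fin_cases i <;> fin_cases j <;> simp [rotationMatrix]

theorem rotationMatrix_pow (θ : ℝ) (m : ℕ) : rotationMatrix θ ^ m = rotationMatrix (m * θ) := by
  induction m with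
  | zero => simp [rotationMatrix_zero]
  | succ m ih => rw [pow_succ, ih, rotationMatrix_mul]; congr 1; push_cast; ring

theorem rotationMatrix_pow_eq_one {k : ℕ} (hk : 0 < k) (j : ℕ) :
    rotationMatrix (Real.pi * j / k) ^ (2 * k) = 1 := by
  have hk' : (k : ℝ) ≠ 0 := by exact_mod_cast hk.ne'
  have h : ((2 * k : ℕ) : ℝ) * (Real.pi * j / k) = j * (2 * Real.pi) := by
    push_cast; field_simp
  rw [rotationMatrix_pow, h, ← rotationMatrix_zero, rotationMatrix, rotationMatrix]
  have hs : Real.sin (j * (2 * Real.pi)) = 0 := by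
    simpa [mul_assoc] using Real.sin_nat_mul_pi (j * 2)
  simp [hs]

theorem rotationMatrix_charpoly (θ : ℝ) :
    ((rotationMatrix θ).map Complex.ofRealHom).charpoly =
      (Polynomial.X - Polynomial.C (Complex.exp (θ * Complex.I))) *
        (Polynomial.X - Polynomial.C ((starRingEnd ℂ) (Complex.exp (θ * Complex.I)))) := by
  have h1 : Complex.exp (θ * Complex.I) + (starRingEnd ℂ) (Complex.exp (θ * Complex.I)) =
      ((rotationMatrix θ).map Complex.ofRealHom).trace := by
    rw [Complex.add_conj, Complex.exp_ofReal_mul_I_re]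
    simp [rotationMatrix, Matrix.trace_fin_two]
    ring
  have h2 : Complex.exp (θ * Complex.I) * (starRingEnd ℂ) (Complex.exp (θ * Complex.I)) =
      ((rotationMatrix θ).map Complex.ofRealHom).det := by
    rw [Complex.mul_conj, Complex.normSq_eq_norm_sq, Complex.norm_exp_ofReal_mul_I]
    have := Complex.cos_sq_add_sin_sq θ
    simp [rotationMatrix, Matrix.det_fin_two]
    linear_combination -this
  rw [Matrix.charpoly_fin_two, ← h1, ← h2, Polynomial.C_add, Polynomial.C_mul]
  ring

/-- Every admissible multiset of eigenvalues is realised by an orthogonal matrix. -/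
theorem exists_orthogonal_rootData {k : ℕ} (hk : 0 < k) {n : ℕ} (ε : ℤˣ)
    (s : Sym (Fin (k + 1)) n) :
    ∃ x : Matrix.orthogonalGroup (Fin (2 * n + 1)) ℝ, x ^ (2 * k) = 1 ∧
      ((x : Matrix (Fin (2 * n + 1)) (Fin (2 * n + 1)) ℝ).map Complex.ofRealHom).charpoly.roots =
        rootData k ε s := by
  obtain ⟨f, hf⟩ : ∃ f : Fin n → Fin (k + 1), (s : Multiset (Fin (k + 1))) =
      Finset.univ.val.map f := by
    obtain ⟨⟨l⟩, hl⟩ := s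
    subst hl
    exact ⟨l.get, ((Fin.univ_val_map l.get).trans (congrArg _ (List.ofFn_get l))).symm⟩
  let θ : Fin n → ℝ := fun i => Real.pi * (f i : ℕ) / k
  let r : Matrix (Fin 2 × Fin n) (Fin 2 × Fin n) ℝ := blockDiagonal fun i => rotationMatrix (θ i)
  let e : Matrix Unit Unit ℝ := diagonal fun _ => ((ε : ℤ) : ℝ)
  let M : Matrix (Unit ⊕ Fin 2 × Fin n) (Unit ⊕ Fin 2 × Fin n) ℝ := fromBlocks e 0 0 r
  have hε : ((ε : ℤ) : ℝ) * ((ε : ℤ) : ℝ) = 1 := by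
    rcases Int.units_eq_one_or ε with rfl | rfl <;> simp
  have hr : rᵀ * r = 1 := by
    simp only [r, blockDiagonal_transpose, ← blockDiagonal_mul, rotationMatrix_transpose,
      rotationMatrix_mul, neg_add_cancel, rotationMatrix_zero]
    exact blockDiagonal_one
  have hM : Mᵀ * M = 1 := by
    simp [M, fromBlocks_transpose, fromBlocks_multiply, hr, e, hε]
  have hMpow : M ^ (2 * k) = 1 := by
    have hrp : r ^ (2 * k) = 1 := by
      simp only [r, ← blockDiagonal_pow]
      rw [← blockDiagonal_one]
      congr 1
      ext1 i
      exact rotationMatrix_pow_eq_one hk _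
    have hep : e ^ (2 * k) = 1 := by
      simp only [e, diagonal_pow]
      rw [← diagonal_one]
      congr 1
      ext1 i
      simp [pow_mul, pow_two, hε]
    simp only [M, fromBlocks_diagonal_pow, hrp, hep, fromBlocks_one]
  have hMchar : (M.map Complex.ofRealHom).charpoly.roots = rootData k ε s := by
    have he : (e.map Complex.ofRealHom).charpoly = Polynomial.X - Polynomial.C ((ε : ℤ) : ℂ) := by
      simp [e, Matrix.charpoly, Matrix.det_unique]
    have hrc : (r.map Complex.ofRealHom).charpoly =
        ∏ i, ((Polynomial.X - Polynomial.C (upperRoot k (f i))) *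
          (Polynomial.X - Polynomial.C ((starRingEnd ℂ) (upperRoot k (f i))))) := by
      rw [blockDiagonal_map _ _ (map_zero _), charpoly_blockDiagonal]
      exact Finset.prod_congr rfl fun i _ => rotationMatrix_charpoly (θ i)
    rw [fromBlocks_map, Matrix.map_zero _ (map_zero _), Matrix.map_zero _ (map_zero _),
      charpoly_fromBlocks_zero₁₂, he, hrc]
    have : ((rootData k ε s).map fun a => Polynomial.X - Polynomial.C a).prod =
        (Polynomial.X - Polynomial.C ((ε : ℤ) : ℂ)) *
        ∏ i, ((Polynomial.X - Polynomial.C (upperRoot k (f i))) *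
          (Polynomial.X - Polynomial.C ((starRingEnd ℂ) (upperRoot k (f i))))) := by
      rw [Finset.prod_mul_distrib]
      simp only [rootData, hf, Finset.prod, Multiset.map_cons, Multiset.map_add,
        Multiset.map_map, Multiset.prod_cons, Multiset.prod_add, Function.comp_def]
    rw [← this, Polynomial.roots_multiset_prod_X_sub_C]
  let E : Unit ⊕ Fin 2 × Fin n ≃ Fin (2 * n + 1) := Fintype.equivFinOfCardEq (by simp; ring)
  let A := reindexAlgEquiv ℝ ℝ E
  refine ⟨⟨A M, ?_⟩, ?_, ?_⟩
  · rw [mem_orthogonalGroup_iff']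
    have : (A M)ᵀ = A Mᵀ := rfl
    rw [this, ← map_mul, hM, map_one]
  · apply Subtype.ext
    change (A M) ^ (2 * k) = 1
    rw [← map_pow, hMpow, map_one]
  · rw [← hMchar, ← charpoly_reindex E]
    rfl

/-- Orthogonal matrices whose `m`-th power is `1` and with the same complex eigenvalues are
conjugate in the orthogonal group. -/
theorem isConj_of_roots_eq {ι : Type*} [Fintype ι] [DecidableEq ι] {m : ℕ} (hm : 0 < m)
    {x y : Matrix.orthogonalGroup ι ℝ} (hx : x ^ m = 1) (hy : y ^ m = 1)
    (h : ((x : Matrix ι ι ℝ).map Complex.ofRealHom).charpoly.roots =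
      ((y : Matrix ι ι ℝ).map Complex.ofRealHom).charpoly.roots) : IsConj x y := by
  have hchar : ((x : Matrix ι ι ℝ).map Complex.ofRealHom).charpoly =
      ((y : Matrix ι ι ℝ).map Complex.ofRealHom).charpoly := by
    rw [(IsAlgClosed.splits _).eq_prod_roots_of_monic (charpoly_monic _), h,
      ← (IsAlgClosed.splits _).eq_prod_roots_of_monic (charpoly_monic _)]
  have hpow : ∀ {x : Matrix.orthogonalGroup ι ℝ}, x ^ m = 1 →
      ((x : Matrix ι ι ℝ).map Complex.ofRealHom) ^ m = 1 := by
    intro x hx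
    rw [← Matrix.map_pow, ← SubmonoidClass.coe_pow, hx]
    simp
  obtain ⟨p, hp, hpxy⟩ := exists_complex_intertwiner hm (hpow hx) (hpow hy) hchar
  obtain ⟨c, hc, hcxy⟩ := exists_real_intertwiner hp hpxy
  obtain ⟨q, hq, hqxy⟩ := exists_orthogonal_intertwiner
    ((mem_orthogonalGroup_iff' _ _).1 x.2) ((mem_orthogonalGroup_iff _ _).1 y.2) hc hcxy
  let g : Matrix.orthogonalGroup ι ℝ := ⟨q, mem_orthogonalGroup_iff' _ _ |>.2 hq⟩
  refine (isConj_iff.2 ⟨g, ?_⟩ : IsConj y x).symm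
  rw [mul_inv_eq_iff_eq_mul]
  exact Subtype.ext hqxy.symm

theorem roots_eq_of_isConj {ι : Type*} [Fintype ι] [DecidableEq ι]
    {x y : Matrix.orthogonalGroup ι ℝ} (h : IsConj x y) :
    ((x : Matrix ι ι ℝ).map Complex.ofRealHom).charpoly.roots =
      ((y : Matrix ι ι ℝ).map Complex.ofRealHom).charpoly.roots := by
  obtain ⟨g, rfl⟩ := isConj_iff.1 h
  have : ((g * x * g⁻¹ : Matrix.orthogonalGroup ι ℝ) : Matrix ι ι ℝ).charpoly =
      (x : Matrix ι ι ℝ).charpoly := by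
    have h := charpoly_units_conj (Unitary.toUnits g) (x : Matrix ι ι ℝ)
    rwa [← coe_units_inv] at h
  rw [charpoly_map, charpoly_map, this]

theorem exists_roots_eq_rootData {k : ℕ} (hk : 0 < k) {n : ℕ}
    {x : Matrix.orthogonalGroup (Fin (2 * n + 1)) ℝ} (hx : x ^ (2 * k) = 1) :
    ∃ (ε : ℤˣ) (s : Sym (Fin (k + 1)) n),
      ((x : Matrix (Fin (2 * n + 1)) (Fin (2 * n + 1)) ℝ).map Complex.ofRealHom).charpoly.roots =
        rootData k ε s := by
  set X := (x : Matrix (Fin (2 * n + 1)) (Fin (2 * n + 1)) ℝ).map Complex.ofRealHom with hX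
  apply exists_eq_rootData hk n
  · rw [← (IsAlgClosed.splits _).natDegree_eq_card_roots, charpoly_natDegree_eq_dim,
      Fintype.card_fin]
  · have := (IsAlgClosed.splits X.charpoly).roots_map (starRingEnd ℂ)
    rw [← this, ← charpoly_map]
    congr 2
    ext i j
    simp [hX]
  · intro z hz
    have hXp : X ^ (2 * k) = 1 := by
      rw [hX, ← Matrix.map_pow, ← SubmonoidClass.coe_pow, hx]
      simp
    have hz' : Module.End.HasEigenvalue (Matrix.toLin' X) z := by
      rw [Module.End.hasEigenvalue_iff_isRoot_charpoly, charpoly_toLin']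
      exact Polynomial.isRoot_of_mem_roots hz
    obtain ⟨v, hv⟩ := hz'.exists_hasEigenvector
    have h1 := hv.pow_apply (2 * k)
    rw [← Matrix.toLin'_pow, hXp, Matrix.toLin'_one, LinearMap.id_apply] at h1
    have h2 : (z ^ (2 * k) - 1) • v = 0 := by rw [sub_smul, ← h1, one_smul, sub_self]
    exact sub_eq_zero.1 ((smul_eq_zero.1 h2).resolve_right hv.2)

/-- For any positive integer `n` and even positive integer `m`, the number of conjugacy
classes of the full orthogonal group `O(2n+1)` consisting of elements `x` with `x ^ m = 1`
equals `2 · C(n + m/2, m/2)`. -/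
theorem stmt_17 (n m : ℕ) (hn : 0 < n) (hm : 0 < m) (heven : Even m) :
    {c : ConjClasses (Matrix.orthogonalGroup (Fin (2 * n + 1)) ℝ) |
        ∀ x ∈ c.carrier, x ^ m = 1}.ncard
      = 2 * Nat.choose (n + m / 2) (m / 2) := by
  obtain ⟨k, rfl⟩ := even_iff_exists_two_mul.1 heven
  have hk : 0 < k := by omega
  choose x hx hroots using fun a : ℤˣ × Sym (Fin (k + 1)) n =>
    exists_orthogonal_rootData hk a.1 a.2
  have hinj : Function.Injective fun a => ConjClasses.mk (x a) := by
    intro a b hab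
    have := roots_eq_of_isConj (ConjClasses.mk_eq_mk_iff_isConj.1 hab)
    rw [hroots, hroots] at this
    obtain ⟨h1, h2⟩ := rootData_injective hk this
    exact Prod.ext h1 (Sym.ext h2)
  have hrange : {c : ConjClasses (Matrix.orthogonalGroup (Fin (2 * n + 1)) ℝ) |
      ∀ x ∈ c.carrier, x ^ (2 * k) = 1} = Set.range fun a => ConjClasses.mk (x a) := by
    ext c
    simp only [Set.mem_ofPred_eq, Set.mem_range]
    constructor
    · intro hc
      obtain ⟨y, rfl⟩ := ConjClasses.exists_rep c
      have hy := hc y ConjClasses.mem_carrier_mk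
      obtain ⟨ε, s, hs⟩ := exists_roots_eq_rootData hk hy
      refine ⟨(ε, s), ConjClasses.mk_eq_mk_iff_isConj.2 ?_⟩
      exact isConj_of_roots_eq hm (hx _) hy ((hroots _).trans hs.symm)
    · rintro ⟨a, rfl⟩ y hy
      rw [ConjClasses.mem_carrier_iff_mk_eq, ConjClasses.mk_eq_mk_iff_isConj] at hy
      obtain ⟨g, hg⟩ := isConj_iff.1 hy.symm
      rw [← hg, conj_pow, hx, mul_one, mul_inv_cancel]
  rw [hrange, ← Set.image_univ, Set.ncard_image_of_injective _ hinj, Set.ncard_univ,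
    Nat.card_eq_fintype_card, Fintype.card_prod, Sym.card_sym_eq_choose, Fintype.card_fin,
    Fintype.card_units_int, Nat.mul_div_cancel_left k two_pos,
    show k + 1 + n - 1 = n + k by omega, Nat.choose_symm_add]
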